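/- Let K ⊂ P be compact. Suppose v_k ∈ C^∞(P;ℝ²) and f_k, f ∈ C^∞(P;[0,∞)) (k ∈ ℕ) satisfy: supp v_k, supp f_k, supp f ⊆ K for all k; |v_k| < min(f_k, f) on supp v_k for all k; and f_k → f and ∇f_k → ∇f uniformly on P as k → ∞. Then ∇p[v_k, f_k] − ∇p[v_k, f] → 0 uniformly on ℝ² as k → ∞. -/

import Mathlib

noncomputable section

open MeasureTheory Real Set Filter Topology

abbrev E3 : Type := EuclideanSpace ℝ (Fin 3)

/-- The point of `ℝ³` with coordinates `(a, b, c)`. -/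
def e3 (a b c : ℝ) : E3 := (EuclideanSpace.equiv (Fin 3) ℝ).symm ![a, b, c]

/-- Spatial partial derivative `∂ᵢ w`. -/
def pd3 (w : E3 → ℝ) (i : Fin 3) (x : E3) : ℝ := fderiv ℝ w x (EuclideanSpace.single i 1)

/-- Laplacian of a scalar function on `ℝ³`. -/
def lap3 (w : E3 → ℝ) (x : E3) : ℝ := ∑ i : Fin 3, pd3 (fun y => pd3 w i y) i x

/-- Divergence of a vector field on `ℝ³`. -/
def div3 (u : E3 → E3) (x : E3) : ℝ := ∑ i : Fin 3, pd3 (fun y => u y i) i x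

/-- `|∇u|²`. -/
def gradsq (u : E3 → E3) (x : E3) : ℝ :=
  ∑ i : Fin 3, ∑ j : Fin 3, (pd3 (fun y => u y j) i x) ^ 2

/-- The pressure function corresponding to a vector field `u`. -/
def pressureFn (u : E3 → E3) (x : E3) : ℝ :=
  ∫ y : E3, (∑ i : Fin 3, ∑ j : Fin 3,
    pd3 (fun z => u z j) i y * pd3 (fun z => u z i) j y) / (4 * π * ‖x - y‖)

/-- Rotation about the `x₁` axis by angle `θ`. -/
def rot3 (θ : ℝ) (x : E3) : E3 :=
  e3 (x 0) (x 1 * Real.cos θ - x 2 * Real.sin θ) (x 1 * Real.sin θ + x 2 * Real.cos θ)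

abbrev Pt : Type := ℝ × ℝ

/-- The open upper half-plane `P`. -/
def Pset : Set Pt := {p | 0 < p.2}

def pdx (g : Pt → ℝ) (p : Pt) : ℝ := fderiv ℝ g p (1, 0)

def pdy (g : Pt → ℝ) (p : Pt) : ℝ := fderiv ℝ g p (0, 1)

/-- The operator `L`, `Lg = Δg + ∂₂ g / x₂ - g / x₂²`. -/
def Lop (g : Pt → ℝ) (p : Pt) : ℝ :=
  (pdx (fun q => pdx g q) p + pdy (fun q => pdy g q) p) + pdy g p / p.2 - g p / p.2 ^ 2

/-- `div (x₂ v(x₁,x₂))` for a planar vector field `v = (w₁, w₂)`. -/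
def div2w (w₁ w₂ : Pt → ℝ) (p : Pt) : ℝ :=
  pdx (fun q => q.2 * w₁ q) p + pdy (fun q => q.2 * w₂ q) p

/-- `g ∈ C₀^∞(P)`. -/
def SmoothCompSuppP (g : Pt → ℝ) : Prop :=
  ContDiff ℝ (⊤ : ℕ∞) g ∧ HasCompactSupport g ∧ tsupport g ⊆ Pset

/-- Distance to the `x₁`-axis. -/
def rad (x : E3) : ℝ := Real.sqrt ((x 1) ^ 2 + (x 2) ^ 2)

/-- The cylindrical projection `R⁻¹`. -/
def Rinv (x : E3) : Pt := (x 0, rad x)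

/-- The rotation `R(V)` of a subset `V` of the (closed) upper half-plane. -/
def Rset (V : Set Pt) : Set E3 := {x | Rinv x ∈ V}

def wcomp (v₁ v₂ f : Pt → ℝ) (p : Pt) : ℝ := Real.sqrt (f p ^ 2 - (v₁ p ^ 2 + v₂ p ^ 2))

/-- The axisymmetric vector field `u[v,f]` determined (in cylindrical coordinates) by
`u[v,f](x₁,x₂,0) = (v₁(x₁,x₂), v₂(x₁,x₂), √(f(x₁,x₂)² − |v(x₁,x₂)|²))` for `x₂ ≥ 0`. -/
def uvf (v₁ v₂ f : Pt → ℝ) (x : E3) : E3 :=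
  e3 (v₁ (Rinv x))
    (v₂ (Rinv x) * (x 1 / rad x) - wcomp v₁ v₂ f (Rinv x) * (x 2 / rad x))
    (v₂ (Rinv x) * (x 2 / rad x) + wcomp v₁ v₂ f (Rinv x) * (x 1 / rad x))

/-- The planar pressure function `p[v,f]`, the restriction to `{x₃ = 0}` of the pressure
function `p*[v,f]` corresponding to `u[v,f]`. -/
def pvf (v₁ v₂ f : Pt → ℝ) (q : Pt) : ℝ := pressureFn (uvf v₁ v₂ f) (e3 q.1 q.2 0)

def zf : Pt → ℝ := fun _ => 0

/-- First component of the pressure interaction function `F[v,f] = ∇p[0,f] − ∇p[v,f]`. -/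
def Fpi1 (v₁ v₂ f : Pt → ℝ) (q : Pt) : ℝ := pdx (pvf zf zf f) q - pdx (pvf v₁ v₂ f) q

/-- Second component of the pressure interaction function `F[v,f] = ∇p[0,f] − ∇p[v,f]`. -/
def Fpi2 (v₁ v₂ f : Pt → ℝ) (q : Pt) : ℝ := pdy (pvf zf zf f) q - pdy (pvf v₁ v₂ f) q

/-- A structure `(v, f, φ)` (with `v = (w₁,w₂)`) on a set `U ⋐ P`. -/
structure StructureOn (U : Set Pt) (w₁ w₂ f φ : Pt → ℝ) : Prop where
  smooth_w₁ : ContDiff ℝ (⊤ : ℕ∞) w₁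
  smooth_w₂ : ContDiff ℝ (⊤ : ℕ∞) w₂
  smooth_f : ContDiff ℝ (⊤ : ℕ∞) f
  smooth_phi : ContDiff ℝ (⊤ : ℕ∞) φ
  hcs_w₁ : HasCompactSupport w₁
  hcs_w₂ : HasCompactSupport w₂
  hcs_f : HasCompactSupport f
  hcs_phi : HasCompactSupport φ
  supp_w₁ : tsupport w₁ ⊆ {p | φ p = 1}
  supp_w₂ : tsupport w₂ ⊆ {p | φ p = 1}
  supp_f : tsupport f = closure U
  f_nonneg : ∀ p, 0 ≤ f p
  phi_mem : ∀ p, φ p ∈ Icc (0:ℝ) 1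
  supp_phi : tsupport φ ⊆ U
  div_v : ∀ p ∈ U, div2w w₁ w₂ p = 0
  f_gt : ∀ p ∈ U, Real.sqrt (w₁ p ^ 2 + w₂ p ^ 2) < f p
  Lf_pos : ∀ p ∈ U, φ p ≠ 1 → 0 < Lop f p

/-- `u` is a weak solution of the Navier–Stokes inequality with viscosity `ν`:
the local energy inequality holds against every nonnegative test function
`φ ∈ C₀^∞(ℝ³ × (0,∞))`. -/
def IsWeakNSI (ν : ℝ) (u : E3 → ℝ → E3) : Prop :=
  ∀ φ : E3 × ℝ → ℝ, ContDiff ℝ (⊤ : ℕ∞) φ → HasCompactSupport φ →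
    tsupport φ ⊆ {z : E3 × ℝ | 0 < z.2} → (∀ z, 0 ≤ φ z) →
    2 * ν * (∫ t in Ioi (0:ℝ), ∫ x : E3, gradsq (fun y => u y t) x * φ (x, t)) ≤
      ∫ t in Ioi (0:ℝ), ∫ x : E3,
        (‖u x t‖ ^ 2 * (deriv (fun s => φ (x, s)) t + ν * lap3 (fun y => φ (y, t)) x)
          + (‖u x t‖ ^ 2 + 2 * pressureFn (fun y => u y t) x) *
              (∑ i : Fin 3, u x t i * pd3 (fun y => φ (y, t)) i x))

/-- The regularity `sup_{t>0} ‖u(t)‖_{L²} < ∞` and `∇u ∈ L²(ℝ³ × (0,∞))`. -/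
def NSIRegular (u : E3 → ℝ → E3) : Prop :=
  (∃ M : ℝ, ∀ t, 0 < t →
    Integrable (fun x : E3 => ‖u x t‖ ^ 2) ∧ (∫ x : E3, ‖u x t‖ ^ 2) ≤ M) ∧
  IntegrableOn (fun z : E3 × ℝ => gradsq (fun y => u y z.2) z.1) (univ ×ˢ Ioi 0)

/-- `u` is unbounded in every neighbourhood of `(x₀, T₀)`. -/
def UnboundedNear (u : E3 → ℝ → E3) (x₀ : E3) (T₀ : ℝ) : Prop :=
  ∀ ε > 0, ∀ M : ℝ, ∃ x : E3, ∃ t : ℝ, 0 < t ∧ ‖x - x₀‖ < ε ∧ |t - T₀| < ε ∧ M < ‖u x t‖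

/-- The singular set of `u`. -/
def SingularSet (u : E3 → ℝ → E3) : Set (E3 × ℝ) :=
  {z | 0 < z.2 ∧ UnboundedNear u z.1 z.2}

/-- `u · (∂_t u + (u·∇)u + ∇p)`, where `p` is the pressure corresponding to `u(·,t)`. -/
def eulerOp (u : E3 → ℝ → E3) (x : E3) (t : ℝ) : ℝ :=
  ∑ j : Fin 3, u x t j *
    (deriv (fun s => u x s j) t
      + (∑ i : Fin 3, u x t i * pd3 (fun y => u y t j) i x)
      + pd3 (pressureFn (fun y => u y t)) j x)

/-- `u · (∂_t u − νΔu + (u·∇)u + ∇p)`, where `p` is the pressure corresponding to `u(·,t)`. -/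
def nsOp (ν : ℝ) (u : E3 → ℝ → E3) (x : E3) (t : ℝ) : ℝ :=
  ∑ j : Fin 3, u x t j *
    (deriv (fun s => u x s j) t - ν * lap3 (fun y => u y t j) x
      + (∑ i : Fin 3, u x t i * pd3 (fun y => u y t j) i x)
      + pd3 (pressureFn (fun y => u y t)) j x)

/-- The time-dependent modification `h_{1,t}` of `f₁`. -/
def h1d (f₁ φ₁ : Pt → ℝ) (δ t : ℝ) (p : Pt) : ℝ :=
  Real.sqrt (f₁ p ^ 2 - 2 * t * δ * φ₁ p)

/-- The time-dependent modification `h_{2,t}` of `f₂`. -/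
def h2d (w₁ w₂ f₁ φ₁ b₁ b₂ f₂ φ₂ : Pt → ℝ) (δ t : ℝ) (p : Pt) : ℝ :=
  Real.sqrt (f₂ p ^ 2 - 2 * t * δ * φ₂ p +
    ∫ s in (0:ℝ)..t,
      (b₁ p * Fpi1 w₁ w₂ (h1d f₁ φ₁ δ s) p + b₂ p * Fpi2 w₁ w₂ (h1d f₁ φ₁ δ s) p))

/-- The constant `D` of Lemma 3.4 (i). -/
def Dconst (w₁ : Pt → ℝ) : ℝ := (9 / (4 * π)) * ∫ y : E3, (w₁ (Rinv y)) ^ 2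

/-- A (planar, open) rectangle. -/
def IsRect (V : Set Pt) : Prop :=
  ∃ a₁ b₁ a₂ b₂ : ℝ, a₁ < b₁ ∧ a₂ < b₂ ∧ V = Ioo a₁ b₁ ×ˢ Ioo a₂ b₂

lemma integrable_indicator_ball_inv_norm_sq :
    Integrable ((Metric.ball (0 : E3) 1).indicator fun z => (‖z‖ ^ 2)⁻¹) := by
  rw [integrable_indicator_iff Metric.isOpen_ball.measurableSet,
    integrableOn_fun_norm_addHaar volume (f := fun r : ℝ => (r ^ 2)⁻¹)]
  have h1 : IntegrableOn (fun _ : ℝ => (1 : ℝ)) (Ioo 0 1) := by simp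
  refine h1.congr_fun (fun r hr => ?_) measurableSet_Ioo
  have : r ≠ 0 := hr.1.ne'
  simp [this]

lemma inv_norm_sq_le (z : E3) :
    (‖z‖ ^ 2)⁻¹ ≤ (Metric.ball (0 : E3) 1).indicator (fun z => (‖z‖ ^ 2)⁻¹) z + 1 := by
  by_cases hz : z ∈ Metric.ball (0 : E3) 1
  · simp [hz]
  · have h1 : 1 ≤ ‖z‖ := by simpa using hz
    have : (‖z‖ ^ 2)⁻¹ ≤ 1 := inv_le_one_of_one_le₀ (one_le_pow₀ h1)
    simpa [hz] using this

lemma locallyIntegrable_newtonKernel :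
    LocallyIntegrable (fun z : E3 => (4 * π * ‖z‖)⁻¹) := by
  have hg : LocallyIntegrable
      (fun z : E3 => (Metric.ball (0 : E3) 1).indicator (fun z => (‖z‖ ^ 2)⁻¹) z + 2) :=
    integrable_indicator_ball_inv_norm_sq.locallyIntegrable.add (locallyIntegrable_const 2)
  refine hg.mono (by fun_prop) (Eventually.of_forall fun z => ?_)
  have h0 : 0 ≤ ‖z‖⁻¹ := by positivity
  have h1 : ‖z‖⁻¹ ≤ (‖z‖ ^ 2)⁻¹ + 1 := by
    rw [← inv_pow]
    nlinarith [sq_nonneg (‖z‖⁻¹ - 1)]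
  have h2 : (4 * π)⁻¹ ≤ 1 := inv_le_one_of_one_le₀ (by linarith [pi_gt_three])
  have h3 : (4 * π * ‖z‖)⁻¹ ≤ ‖z‖⁻¹ := by
    rw [mul_inv]
    exact mul_le_of_le_one_left h0 h2
  rw [norm_of_nonneg (by positivity)]
  exact (by linarith [inv_norm_sq_le z] : _ ≤ _).trans (le_abs_self _)

lemma contDiff_newtonPotential {S : E3 → ℝ} (hS : ContDiff ℝ 1 S) (hc : HasCompactSupport S) :
    ContDiff ℝ 1 fun x => ∫ y, S y / (4 * π * ‖x - y‖) := by
  simpa [convolution_def, div_eq_mul_inv] using!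
    hc.contDiff_convolution_left (ContinuousLinearMap.mul ℝ ℝ) (n := 1) hS
      locallyIntegrable_newtonKernel

lemma integrable_newtonPotential {S : E3 → ℝ} (hS : Continuous S) (hc : HasCompactSupport S)
    (x : E3) : Integrable fun y => S y / (4 * π * ‖x - y‖) := by
  simpa [ConvolutionExistsAt, div_eq_mul_inv] using!
    hc.convolutionExists_left (ContinuousLinearMap.mul ℝ ℝ) hS
      locallyIntegrable_newtonKernel x

lemma abs_inv_sub_inv_le {a b d : ℝ} (ha : 0 ≤ a) (hb : 0 ≤ b) (h : |a - b| ≤ d) :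
    |a⁻¹ - b⁻¹| ≤ d * ((a ^ 2)⁻¹ + (b ^ 2)⁻¹) := by
  have hd : 0 ≤ d := (abs_nonneg _).trans h
  rcases ha.eq_or_lt with rfl | ha
  · rcases hb.eq_or_lt with rfl | hb
    · simp
    · rw [zero_sub, abs_neg, abs_of_pos hb] at h
      have : b⁻¹ = b * (b ^ 2)⁻¹ := by field_simp
      simp only [inv_zero, zero_sub, abs_neg, ne_eq, OfNat.ofNat_ne_zero, not_false_eq_true,
        zero_pow, zero_add]
      rw [abs_of_pos (by positivity), this]
      gcongr
  · rcases hb.eq_or_lt with rfl | hb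
    · rw [sub_zero, abs_of_pos ha] at h
      have : a⁻¹ = a * (a ^ 2)⁻¹ := by field_simp
      simp only [inv_zero, sub_zero, ne_eq, OfNat.ofNat_ne_zero, not_false_eq_true,
        zero_pow, add_zero]
      rw [abs_of_pos (by positivity), this]
      gcongr
    · have h1 : a⁻¹ - b⁻¹ = (b - a) * (a⁻¹ * b⁻¹) := by field_simp
      rw [h1, abs_mul, abs_sub_comm, abs_of_pos (by positivity : 0 < a⁻¹ * b⁻¹), ← inv_pow,
        ← inv_pow]
      gcongr
      nlinarith [sq_nonneg (a⁻¹ - b⁻¹), sq_nonneg (a⁻¹ + b⁻¹)]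

/-- The Newtonian potential of a bounded density supported in a fixed ball is Lipschitz, with
constant proportional to the bound on the density. -/
lemma exists_lipschitz_newtonPotential (R : ℝ) :
    ∃ C, 0 ≤ C ∧ ∀ (S : E3 → ℝ) (ε : ℝ), Continuous S → HasCompactSupport S → 0 ≤ ε →
      (∀ y, |S y| ≤ ε) → (∀ y, y ∉ Metric.closedBall 0 R → S y = 0) → ∀ x x' : E3,
      |(∫ y, S y / (4 * π * ‖x - y‖)) - ∫ y, S y / (4 * π * ‖x' - y‖)| ≤ C * ε * ‖x - x'‖ := by
  set h : E3 → ℝ := (Metric.ball (0 : E3) 1).indicator fun z => (‖z‖ ^ 2)⁻¹ with hh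
  set B : E3 → ℝ := (Metric.closedBall (0 : E3) R).indicator fun _ => 2 with hB
  have hint : Integrable h := integrable_indicator_ball_inv_norm_sq
  have hh0 : ∀ z, 0 ≤ h z := indicator_nonneg fun z _ => by positivity
  have hB0 : ∀ z, 0 ≤ B z := indicator_nonneg fun z _ => by positivity
  have hBint : Integrable B :=
    (integrable_indicator_iff Metric.isClosed_closedBall.measurableSet).2
      (integrableOn_const (isCompact_closedBall (0 : E3) R).measure_lt_top.ne)
  refine ⟨2 * (∫ z, h z) + ∫ z, B z, by
    have : 0 ≤ ∫ z, h z := integral_nonneg hh0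
    have : 0 ≤ ∫ z, B z := integral_nonneg hB0
    positivity, fun S ε hS hc hε hb hsup x x' => ?_⟩
  rw [← integral_sub (integrable_newtonPotential hS hc x) (integrable_newtonPotential hS hc x')]
  have hhx : ∀ x : E3, Integrable fun y => h (x - y) := fun x => hint.comp_sub_left x
  have hG : Integrable fun y => ε * ‖x - x'‖ * (h (x - y) + h (x' - y) + B y) :=
    (((hhx x).add (hhx x')).add hBint).const_mul _
  rw [← norm_eq_abs]
  refine (norm_integral_le_of_norm_le hG (Eventually.of_forall fun y => ?_)).trans (le_of_eq ?_)
  · by_cases hy : y ∈ Metric.closedBall (0 : E3) R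
    · have hBy : B y = 2 := by simp only [hB, indicator_of_mem hy]
      have h1 : S y / (4 * π * ‖x - y‖) - S y / (4 * π * ‖x' - y‖) =
          S y * ((4 * π)⁻¹ * (‖x - y‖⁻¹ - ‖x' - y‖⁻¹)) := by
        simp only [div_eq_mul_inv, mul_inv]; ring
      have h2 : |‖x - y‖⁻¹ - ‖x' - y‖⁻¹| ≤
          ‖x - x'‖ * ((‖x - y‖ ^ 2)⁻¹ + (‖x' - y‖ ^ 2)⁻¹) := by
        refine abs_inv_sub_inv_le (norm_nonneg _) (norm_nonneg _) ?_
        simpa using abs_norm_sub_norm_le (x - y) (x' - y)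
      have h3 : (4 * π)⁻¹ ≤ 1 := inv_le_one_of_one_le₀ (by linarith [pi_gt_three])
      rw [h1, norm_mul, norm_mul, norm_of_nonneg (by positivity : 0 ≤ (4 * π)⁻¹), hBy]
      simp only [norm_eq_abs]
      have h4 := inv_norm_sq_le (x - y)
      have h5 := inv_norm_sq_le (x' - y)
      rw [mul_assoc]
      refine mul_le_mul (hb y) ?_ (by positivity) hε
      refine (mul_le_of_le_one_left (abs_nonneg _) h3).trans (h2.trans ?_)
      exact mul_le_mul_of_nonneg_left (by linarith) (norm_nonneg _)
    · rw [hsup y hy]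
      have := hh0 (x - y)
      have := hh0 (x' - y)
      have := hB0 y
      simp only [zero_div, sub_self, norm_zero]
      positivity
  · have h1 := integral_add ((hhx x).add (hhx x')) hBint
    have h2 := integral_add (hhx x) (hhx x')
    simp only [Pi.add_apply, integral_sub_left_eq_self h volume] at h1 h2
    rw [integral_const_mul, h1, h2]
    ring

lemma continuous_rad : Continuous rad := by
  unfold rad
  fun_prop

lemma continuous_Rinv : Continuous Rinv := by
  have := continuous_rad
  unfold Rinv
  fun_prop

lemma sq_rad (y : E3) : rad y ^ 2 = y 1 ^ 2 + y 2 ^ 2 := sq_sqrt (by positivity)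

lemma norm_le_two_mul_norm_Rinv (y : E3) : ‖y‖ ≤ 2 * ‖Rinv y‖ := by
  have h0 : |y 0| ≤ ‖Rinv y‖ := norm_fst_le (Rinv y)
  have h1 : |rad y| ≤ ‖Rinv y‖ := norm_snd_le (Rinv y)
  refine abs_le_of_sq_le_sq' ?_ (by positivity) |>.2
  rw [EuclideanSpace.real_norm_sq_eq, Fin.sum_univ_three]
  have h2 := sq_rad y
  have h3 := sq_le_sq' (abs_le.1 h0).1 (abs_le.1 h0).2
  have h4 := sq_le_sq' (abs_le.1 h1).1 (abs_le.1 h1).2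
  nlinarith

lemma contDiffAt_rad {n : WithTop ℕ∞} {y : E3} (hy : 0 < rad y) : ContDiffAt ℝ n rad y := by
  have h : y 1 ^ 2 + y 2 ^ 2 ≠ 0 := by rw [← sq_rad]; positivity
  unfold rad
  exact ContDiffAt.sqrt (by fun_prop) h

lemma contDiffAt_Rinv {n : WithTop ℕ∞} {y : E3} (hy : 0 < rad y) : ContDiffAt ℝ n Rinv y := by
  have := contDiffAt_rad (n := n) hy
  unfold Rinv
  fun_prop

lemma pd3_coord (i j : Fin 3) (y : E3) : pd3 (fun z => z j) i y = if j = i then 1 else 0 := by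
  have : HasFDerivAt (fun z : E3 => z j) (EuclideanSpace.proj j : E3 →L[ℝ] ℝ) y :=
    (EuclideanSpace.proj j : E3 →L[ℝ] ℝ).hasFDerivAt
  rw [pd3, this.fderiv]
  simp

lemma pd3_add {F G : E3 → ℝ} {y : E3} (hF : DifferentiableAt ℝ F y) (hG : DifferentiableAt ℝ G y)
    (i : Fin 3) : pd3 (fun z => F z + G z) i y = pd3 F i y + pd3 G i y := by
  simp [pd3, fderiv_fun_add hF hG]

lemma pd3_sub {F G : E3 → ℝ} {y : E3} (hF : DifferentiableAt ℝ F y) (hG : DifferentiableAt ℝ G y)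
    (i : Fin 3) : pd3 (fun z => F z - G z) i y = pd3 F i y - pd3 G i y := by
  simp [pd3, fderiv_fun_sub hF hG]

lemma pd3_mul {F G : E3 → ℝ} {y : E3} (hF : DifferentiableAt ℝ F y) (hG : DifferentiableAt ℝ G y)
    (i : Fin 3) : pd3 (fun z => F z * G z) i y = F y * pd3 G i y + G y * pd3 F i y := by
  simp [pd3, fderiv_fun_mul hF hG]

lemma pd3_rad {y : E3} (hy : 0 < rad y) (i : Fin 3) :
    pd3 rad i y = (![0, y 1, y 2] : Fin 3 → ℝ) i / rad y := by
  have hd : DifferentiableAt ℝ rad y := (contDiffAt_rad (n := 1) hy).differentiableAt (by simp)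
  have hc : ∀ j : Fin 3, DifferentiableAt ℝ (fun z : E3 => z j) y := fun j => by fun_prop
  have h1 := pd3_mul hd hd i
  have h2 : (fun z => rad z * rad z) = fun z : E3 => z 1 * z 1 + z 2 * z 2 := by
    ext z
    rw [← sq, sq_rad]
    ring
  rw [h2, pd3_add ((hc 1).fun_mul (hc 1)) ((hc 2).fun_mul (hc 2)), pd3_mul (hc 1) (hc 1),
    pd3_mul (hc 2) (hc 2), pd3_coord, pd3_coord] at h1
  rw [eq_div_iff hy.ne', (by linarith : pd3 rad i y * rad y =
    (y 1 * (if (1 : Fin 3) = i then 1 else 0) + y 2 * if (2 : Fin 3) = i then 1 else 0))]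
  fin_cases i <;> simp

lemma contDiffAt_coord_div_rad {n : WithTop ℕ∞} {y : E3} (hy : 0 < rad y) (j : Fin 3) :
    ContDiffAt ℝ n (fun z => z j / rad z) y :=
  ContDiffAt.div (by fun_prop) (contDiffAt_rad hy) hy.ne'

lemma pd3_coord_div_rad {y : E3} (hy : 0 < rad y) (i j : Fin 3) :
    pd3 (fun z => z j / rad z) i y =
      (if j = i then 1 else 0) / rad y - y j / rad y * pd3 rad i y / rad y := by
  have hd : DifferentiableAt ℝ rad y := (contDiffAt_rad (n := 1) hy).differentiableAt (by simp)
  have hc : DifferentiableAt ℝ (fun z : E3 => z j) y := by fun_prop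
  have hq : DifferentiableAt ℝ (fun z => z j / rad z) y :=
    (contDiffAt_coord_div_rad (n := 1) hy j).differentiableAt (by simp)
  have h1 := pd3_mul hd hq i
  have h2 : (fun z => rad z * (z j / rad z)) =ᶠ[𝓝 y] fun z : E3 => z j := by
    filter_upwards [continuous_rad.continuousAt.eventually (lt_mem_nhds hy)] with z hz
    have hz' : rad z ≠ 0 := ne_of_gt hz
    field_simp
  have h3 : pd3 (fun z => rad z * (z j / rad z)) i y = if j = i then 1 else 0 := by
    rw [← pd3_coord i j y, pd3, pd3, h2.fderiv_eq]
  rw [h3] at h1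
  rw [h1]
  field_simp
  ring

lemma pd3_comp_Rinv {g : Pt → ℝ} {y : E3} (hy : 0 < rad y) (hg : DifferentiableAt ℝ g (Rinv y))
    (i : Fin 3) : pd3 (fun z => g (Rinv z)) i y =
      (if 0 = i then 1 else 0) * pdx g (Rinv y) + pd3 rad i y * pdy g (Rinv y) := by
  have hd : DifferentiableAt ℝ rad y := (contDiffAt_rad (n := 1) hy).differentiableAt (by simp)
  have hc : DifferentiableAt ℝ (fun z : E3 => z 0) y := by fun_prop
  have h1 : HasFDerivAt Rinv _ y := hc.hasFDerivAt.prodMk hd.hasFDerivAt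
  have h2 := hg.hasFDerivAt.comp y h1
  rw [pd3, show (fun z => g (Rinv z)) = g ∘ Rinv from rfl, h2.fderiv]
  have h3 : fderiv ℝ (fun z : E3 => z 0) y (EuclideanSpace.single i 1) = if 0 = i then 1 else 0 :=
    pd3_coord i 0 y
  have h4 : ∀ s t : ℝ, fderiv ℝ g (Rinv y) (s, t) = s * pdx g (Rinv y) + t * pdy g (Rinv y) := by
    intro s t
    have : ((s, t) : Pt) = s • (1, 0) + t • (0, 1) := by simp
    rw [this, map_add, map_smul, map_smul]
    rfl
  simp only [ContinuousLinearMap.comp_apply, ContinuousLinearMap.prod_apply]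
  rw [h4, h3]
  rfl

/-- The source `∂ᵢuⱼ ∂ⱼuᵢ` of the pressure function. -/
def pressureSource (u : E3 → E3) (y : E3) : ℝ :=
  ∑ i : Fin 3, ∑ j : Fin 3, pd3 (fun z => u z j) i y * pd3 (fun z => u z i) j y

lemma uvf_apply_zero (v₁ v₂ f : Pt → ℝ) :
    (fun z => uvf v₁ v₂ f z 0) = fun z => v₁ (Rinv z) := by
  ext z; simp [uvf, e3]

lemma uvf_apply_one (v₁ v₂ f : Pt → ℝ) : (fun z => uvf v₁ v₂ f z 1) =
    fun z => v₂ (Rinv z) * (z 1 / rad z) - wcomp v₁ v₂ f (Rinv z) * (z 2 / rad z) := by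
  ext z; simp [uvf, e3]

lemma uvf_apply_two (v₁ v₂ f : Pt → ℝ) : (fun z => uvf v₁ v₂ f z 2) =
    fun z => v₂ (Rinv z) * (z 2 / rad z) + wcomp v₁ v₂ f (Rinv z) * (z 1 / rad z) := by
  ext z; simp [uvf, e3]

/-- The pressure source of an axisymmetric field in cylindrical coordinates: the swirl component
enters only through `∂₂(w²) / x₂`. -/
lemma pressureSource_uvf {v₁ v₂ f : Pt → ℝ} {y : E3} (hy : 0 < rad y)
    (h₁ : DifferentiableAt ℝ v₁ (Rinv y)) (h₂ : DifferentiableAt ℝ v₂ (Rinv y))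
    (hw : DifferentiableAt ℝ (wcomp v₁ v₂ f) (Rinv y)) :
    pressureSource (uvf v₁ v₂ f) y =
      pdx v₁ (Rinv y) ^ 2 + 2 * pdy v₁ (Rinv y) * pdx v₂ (Rinv y) + pdy v₂ (Rinv y) ^ 2 +
        (v₂ (Rinv y) / rad y) ^ 2 -
        2 * wcomp v₁ v₂ f (Rinv y) * pdy (wcomp v₁ v₂ f) (Rinv y) / rad y := by
  have hR : DifferentiableAt ℝ Rinv y := (contDiffAt_Rinv (n := 1) hy).differentiableAt (by simp)
  have hq : ∀ j : Fin 3, DifferentiableAt ℝ (fun z : E3 => z j / rad z) y := fun j =>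
    (contDiffAt_coord_div_rad (n := 1) hy j).differentiableAt (by simp)
  have hb : DifferentiableAt ℝ (fun z => v₂ (Rinv z)) y := h₂.comp y hR
  have hw' : DifferentiableAt ℝ (fun z => wcomp v₁ v₂ f (Rinv z)) y := hw.comp y hR
  have hcs : (y 1 / rad y) ^ 2 + (y 2 / rad y) ^ 2 = 1 := by
    rw [div_pow, div_pow, ← add_div, ← sq_rad]
    exact div_self (by positivity)
  simp only [pressureSource, Fin.sum_univ_three, uvf_apply_zero, uvf_apply_one, uvf_apply_two,
    pd3_sub (hb.fun_mul (hq _)) (hw'.fun_mul (hq _)), pd3_add (hb.fun_mul (hq _)) (hw'.fun_mul (hq _)),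
    pd3_mul hb (hq _), pd3_mul hw' (hq _), pd3_comp_Rinv hy h₁, pd3_comp_Rinv hy h₂,
    pd3_comp_Rinv hy hw, pd3_coord_div_rad hy, pd3_rad hy]
  simp
  generalize y 1 / rad y = c at *
  generalize y 2 / rad y = s at *
  generalize v₂ (Rinv y) = b at *
  generalize wcomp v₁ v₂ f (Rinv y) = w at *
  generalize pdx v₁ (Rinv y) = ax at *
  generalize pdy v₁ (Rinv y) = ar at *
  generalize pdx v₂ (Rinv y) = bx at *
  generalize pdy v₂ (Rinv y) = br at *
  generalize pdx (wcomp v₁ v₂ f) (Rinv y) = wx at *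
  generalize pdy (wcomp v₁ v₂ f) (Rinv y) = wr at *
  simp only [div_eq_mul_inv]
  generalize (rad y)⁻¹ = k at *
  rw [show k - c * c * k = s * s * k by linear_combination (-k) * hcs,
    show k - s * s * k = c * c * k by linear_combination (-k) * hcs]
  linear_combination (2 * ar * bx +
    (br ^ 2 + b ^ 2 * k ^ 2 - 2 * w * wr * k) * (c ^ 2 + s ^ 2 + 1)) * hcs

section Swirl

variable {v₁ v₂ f : Pt → ℝ}

lemma sq_lt_sq_of_mem_tsupport
    (hlt : ∀ p ∈ tsupport v₁ ∪ tsupport v₂, √(v₁ p ^ 2 + v₂ p ^ 2) < f p) {p : Pt}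
    (hp : p ∈ tsupport v₁ ∪ tsupport v₂) : 0 < f p ^ 2 - (v₁ p ^ 2 + v₂ p ^ 2) :=
  sub_pos.2 (lt_sq_of_sqrt_lt (hlt p hp))

lemma sq_wcomp (hlt : ∀ p ∈ tsupport v₁ ∪ tsupport v₂, √(v₁ p ^ 2 + v₂ p ^ 2) < f p) (p : Pt) :
    wcomp v₁ v₂ f p ^ 2 = f p ^ 2 - (v₁ p ^ 2 + v₂ p ^ 2) := by
  refine sq_sqrt ?_
  by_cases hp : p ∈ tsupport v₁ ∪ tsupport v₂
  · exact (sq_lt_sq_of_mem_tsupport hlt hp).le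
  · have h1 : v₁ p = 0 := image_eq_zero_of_notMem_tsupport fun h => hp (.inl h)
    have h2 : v₂ p = 0 := image_eq_zero_of_notMem_tsupport fun h => hp (.inr h)
    simpa [h1, h2] using sq_nonneg (f p)

lemma contDiff_wcomp {n : WithTop ℕ∞} (h₁ : ContDiff ℝ n v₁) (h₂ : ContDiff ℝ n v₂)
    (hf : ContDiff ℝ n f) (hf0 : ∀ p, 0 ≤ f p)
    (hlt : ∀ p ∈ tsupport v₁ ∪ tsupport v₂, √(v₁ p ^ 2 + v₂ p ^ 2) < f p) :
    ContDiff ℝ n (wcomp v₁ v₂ f) := by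
  refine contDiff_iff_contDiffAt.2 fun p => ?_
  by_cases hp : p ∈ tsupport v₁ ∪ tsupport v₂
  · exact ContDiffAt.sqrt (by fun_prop) (sq_lt_sq_of_mem_tsupport hlt hp).ne'
  · have hcl : IsClosed (tsupport v₁ ∪ tsupport v₂) :=
      (isClosed_tsupport _).union (isClosed_tsupport _)
    refine hf.contDiffAt.congr_of_eventuallyEq ?_
    filter_upwards [hcl.isOpen_compl.mem_nhds hp] with q hq
    have h1 : v₁ q = 0 := image_eq_zero_of_notMem_tsupport fun h => hq (.inl h)
    have h2 : v₂ q = 0 := image_eq_zero_of_notMem_tsupport fun h => hq (.inr h)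
    simp [wcomp, h1, h2, sqrt_sq (hf0 q)]

lemma two_mul_wcomp_mul_pdy
    (h₁ : ContDiff ℝ 1 v₁) (h₂ : ContDiff ℝ 1 v₂) (hf : ContDiff ℝ 1 f) (hf0 : ∀ p, 0 ≤ f p)
    (hlt : ∀ p ∈ tsupport v₁ ∪ tsupport v₂, √(v₁ p ^ 2 + v₂ p ^ 2) < f p) (p : Pt) :
    2 * wcomp v₁ v₂ f p * pdy (wcomp v₁ v₂ f) p =
      2 * f p * pdy f p - (2 * v₁ p * pdy v₁ p + 2 * v₂ p * pdy v₂ p) := by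
  have hd : ∀ g : Pt → ℝ, ContDiff ℝ 1 g →
      HasFDerivAt (fun q => g q ^ 2) ((2 * g p) • fderiv ℝ g p) p := fun g hg => by
    simpa using (hg.differentiable (by simp) p).hasFDerivAt.pow 2
  have hw := hd _ (contDiff_wcomp h₁ h₂ hf hf0 hlt)
  have h := (hd f hf).sub ((hd v₁ h₁).add (hd v₂ h₂))
  rw [funext (sq_wcomp hlt)] at hw
  simpa [pdy] using DFunLike.congr_fun (hw.unique h) ((0, 1) : Pt)

variable {K : Set Pt}

lemma eventually_Rinv_notMem (hK : IsClosed K) {y : E3} (hy : Rinv y ∉ K) :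
    ∀ᶠ z in 𝓝 y, Rinv z ∉ K :=
  continuous_Rinv.continuousAt.eventually (hK.isOpen_compl.mem_nhds hy)

lemma uvf_eq_zero (h₁ : tsupport v₁ ⊆ K) (h₂ : tsupport v₂ ⊆ K) (hf : tsupport f ⊆ K) {y : E3}
    (hy : Rinv y ∉ K) : uvf v₁ v₂ f y = 0 := by
  have h1 : v₁ (Rinv y) = 0 := image_eq_zero_of_notMem_tsupport fun h => hy (h₁ h)
  have h2 : v₂ (Rinv y) = 0 := image_eq_zero_of_notMem_tsupport fun h => hy (h₂ h)
  have h3 : f (Rinv y) = 0 := image_eq_zero_of_notMem_tsupport fun h => hy (hf h)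
  ext i
  fin_cases i <;> simp [uvf, e3, wcomp, h1, h2, h3]

lemma contDiff_uvf_apply {n : WithTop ℕ∞} (hK : IsClosed K) (hKP : K ⊆ Pset)
    (h₁ : ContDiff ℝ n v₁) (h₂ : ContDiff ℝ n v₂) (hw : ContDiff ℝ n (wcomp v₁ v₂ f))
    (hs₁ : tsupport v₁ ⊆ K) (hs₂ : tsupport v₂ ⊆ K) (hsf : tsupport f ⊆ K) (i : Fin 3) :
    ContDiff ℝ n fun y => uvf v₁ v₂ f y i := by
  refine contDiff_iff_contDiffAt.2 fun y => ?_
  by_cases hy : Rinv y ∈ K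
  · have hr : 0 < rad y := hKP hy
    have hR := contDiffAt_Rinv (n := n) hr
    have hq := contDiffAt_coord_div_rad (n := n) hr
    have ha : ContDiffAt ℝ n (fun z => v₁ (Rinv z)) y := h₁.contDiffAt.comp y hR
    have hb : ContDiffAt ℝ n (fun z => v₂ (Rinv z)) y := h₂.contDiffAt.comp y hR
    have hc : ContDiffAt ℝ n (fun z => wcomp v₁ v₂ f (Rinv z)) y := hw.contDiffAt.comp y hR
    fin_cases i
    · simpa only [Fin.zero_eta, uvf_apply_zero] using ha
    · simpa only [Fin.mk_one, uvf_apply_one] using (hb.mul (hq 1)).sub (hc.mul (hq 2))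
    · simpa only [Fin.reduceFinMk, uvf_apply_two] using (hb.mul (hq 2)).add (hc.mul (hq 1))
  · refine contDiffAt_const (c := (0 : ℝ)) |>.congr_of_eventuallyEq ?_
    filter_upwards [eventually_Rinv_notMem hK hy] with z hz
    simp [uvf_eq_zero hs₁ hs₂ hsf hz]

lemma pressureSource_uvf_eq_zero (hK : IsClosed K) (hs₁ : tsupport v₁ ⊆ K)
    (hs₂ : tsupport v₂ ⊆ K) (hsf : tsupport f ⊆ K) {y : E3} (hy : Rinv y ∉ K) :
    pressureSource (uvf v₁ v₂ f) y = 0 := by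
  have h : ∀ i j, pd3 (fun z => uvf v₁ v₂ f z j) i y = 0 := fun i j => by
    have : (fun z => uvf v₁ v₂ f z j) =ᶠ[𝓝 y] fun _ => 0 := by
      filter_upwards [eventually_Rinv_notMem hK hy] with z hz
      simp [uvf_eq_zero hs₁ hs₂ hsf hz]
    simp [pd3, this.fderiv_eq]
  simp [pressureSource, h]

lemma contDiff_pressureSource {u : E3 → E3} (hu : ∀ i, ContDiff ℝ 2 fun y => u y i) :
    ContDiff ℝ 1 (pressureSource u) := by
  have h : ∀ i j, ContDiff ℝ 1 (pd3 (fun z => u z j) i) := fun i j =>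
    ((hu j).fderiv_right (m := 1) (by norm_num)).clm_apply contDiff_const
  unfold pressureSource
  exact ContDiff.sum fun i _ => ContDiff.sum fun j _ => (h i j).mul (h j i)

lemma norm_e3_sub_e3_le (q q' : Pt) : ‖e3 q.1 q.2 0 - e3 q'.1 q'.2 0‖ ≤ 2 * ‖q - q'‖ := by
  have h1 : |q.1 - q'.1| ≤ ‖q - q'‖ := norm_fst_le (q - q')
  have h2 : |q.2 - q'.2| ≤ ‖q - q'‖ := norm_snd_le (q - q')
  refine abs_le_of_sq_le_sq' ?_ (by positivity) |>.2
  rw [EuclideanSpace.real_norm_sq_eq, Fin.sum_univ_three]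
  have h3 := sq_le_sq' (abs_le.1 h1).1 (abs_le.1 h1).2
  have h4 := sq_le_sq' (abs_le.1 h2).1 (abs_le.1 h2).2
  simp [e3]
  nlinarith

end Swirl

/-- The gradient of the pressure depends on the swirl magnitude only through the (uniform) size of
the difference of `f ∂₂f`. -/
lemma exists_pdx_pdy_pvf_sub_le {K : Set Pt} (hK : IsCompact K) (hKP : K ⊆ Pset) :
    ∃ C, 0 ≤ C ∧ ∀ (v₁ v₂ f g : Pt → ℝ) (ε : ℝ),
      ContDiff ℝ 2 v₁ → ContDiff ℝ 2 v₂ → ContDiff ℝ 2 f → ContDiff ℝ 2 g →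
      (∀ p, 0 ≤ f p) → (∀ p, 0 ≤ g p) →
      tsupport v₁ ⊆ K → tsupport v₂ ⊆ K → tsupport f ⊆ K → tsupport g ⊆ K →
      (∀ p ∈ tsupport v₁ ∪ tsupport v₂, √(v₁ p ^ 2 + v₂ p ^ 2) < f p) →
      (∀ p ∈ tsupport v₁ ∪ tsupport v₂, √(v₁ p ^ 2 + v₂ p ^ 2) < g p) → 0 ≤ ε →
      (∀ p ∈ K, |f p * pdy f p - g p * pdy g p| ≤ ε) → ∀ q,
      |pdx (pvf v₁ v₂ f) q - pdx (pvf v₁ v₂ g) q| ≤ C * ε ∧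
        |pdy (pvf v₁ v₂ f) q - pdy (pvf v₁ v₂ g) q| ≤ C * ε := by
  obtain ⟨R, hR⟩ := hK.isBounded.exists_norm_le
  obtain ⟨r, hr0, hr⟩ : ∃ r : ℝ, 0 < r ∧ ∀ p ∈ K, r ≤ p.2 :=
    hK.exists_forall_le' continuous_snd.continuousOn fun p hp => hKP hp
  obtain ⟨C, hC0, hC⟩ := exists_lipschitz_newtonPotential (2 * R)
  refine ⟨2 * C * (2 / r), by positivity, ?_⟩
  intro v₁ v₂ f g ε h₁ h₂ hf hg hf0 hg0 hs₁ hs₂ hsf hsg hltf hltg hε hfg q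
  have hsup : ∀ y : E3, y ∉ Metric.closedBall 0 (2 * R) → Rinv y ∉ K := fun y hy hyK => by
    refine hy (mem_closedBall_zero_iff.2 ((norm_le_two_mul_norm_Rinv y).trans ?_))
    linarith [hR _ hyK]
  have key : ∀ h : Pt → ℝ, ContDiff ℝ 2 h → (∀ p, 0 ≤ h p) → tsupport h ⊆ K →
      (∀ p ∈ tsupport v₁ ∪ tsupport v₂, √(v₁ p ^ 2 + v₂ p ^ 2) < h p) →
      ContDiff ℝ 1 (pressureSource (uvf v₁ v₂ h)) ∧
        HasCompactSupport (pressureSource (uvf v₁ v₂ h)) := fun h hh hh0 hsh hlth =>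
    ⟨contDiff_pressureSource (contDiff_uvf_apply hK.isClosed hKP h₁ h₂
      (contDiff_wcomp h₁ h₂ hh hh0 hlth) hs₁ hs₂ hsh),
      HasCompactSupport.intro (isCompact_closedBall 0 (2 * R)) fun y hy =>
        pressureSource_uvf_eq_zero hK.isClosed hs₁ hs₂ hsh (hsup y hy)⟩
  have formula : ∀ h : Pt → ℝ, ContDiff ℝ 2 h → (∀ p, 0 ≤ h p) →
      (∀ p ∈ tsupport v₁ ∪ tsupport v₂, √(v₁ p ^ 2 + v₂ p ^ 2) < h p) →
      ∀ y, Rinv y ∈ K → pressureSource (uvf v₁ v₂ h) y =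
        pdx v₁ (Rinv y) ^ 2 + 2 * pdy v₁ (Rinv y) * pdx v₂ (Rinv y) + pdy v₂ (Rinv y) ^ 2 +
        (v₂ (Rinv y) / rad y) ^ 2 - (2 * h (Rinv y) * pdy h (Rinv y) -
          (2 * v₁ (Rinv y) * pdy v₁ (Rinv y) + 2 * v₂ (Rinv y) * pdy v₂ (Rinv y))) / rad y := by
    intro h hh hh0 hlth y hy
    have hle : (1 : WithTop ℕ∞) ≤ 2 := by norm_num
    rw [pressureSource_uvf (hKP hy) (h₁.differentiable (by simp) _)
      (h₂.differentiable (by simp) _)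
      ((contDiff_wcomp h₁ h₂ hh hh0 hlth).differentiable (by simp) _),
      two_mul_wcomp_mul_pdy (h₁.of_le hle) (h₂.of_le hle) (hh.of_le hle) hh0 hlth]
  obtain ⟨hSf, hcf⟩ := key f hf hf0 hsf hltf
  obtain ⟨hSg, hcg⟩ := key g hg hg0 hsg hltg
  set Sf := pressureSource (uvf v₁ v₂ f)
  set Sg := pressureSource (uvf v₁ v₂ g)
  have hbound : ∀ y, |(Sf - Sg) y| ≤ 2 / r * ε := fun y => by
    by_cases hy : Rinv y ∈ K
    · have hry : r ≤ rad y := hr _ hy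
      have hpos : 0 < rad y := hKP hy
      have h1 : (Sf - Sg) y = -(2 / rad y *
          (f (Rinv y) * pdy f (Rinv y) - g (Rinv y) * pdy g (Rinv y))) := by
        rw [Pi.sub_apply, show Sf y = _ from formula f hf hf0 hltf y hy,
          show Sg y = _ from formula g hg hg0 hltg y hy]
        ring
      rw [h1, abs_neg, abs_mul, abs_of_pos (by positivity : 0 < 2 / rad y)]
      have := hfg _ hy
      gcongr
    · have h1 : Sf y = 0 := pressureSource_uvf_eq_zero hK.isClosed hs₁ hs₂ hsf hy
      have h2 : Sg y = 0 := pressureSource_uvf_eq_zero hK.isClosed hs₁ hs₂ hsg hy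
      rw [Pi.sub_apply, h1, h2, sub_self, abs_zero]
      positivity
  have hlip := hC (Sf - Sg) (2 / r * ε) (hSf.continuous.sub hSg.continuous) (hcf.sub hcg)
    (by positivity) hbound fun y hy => by
      have h1 : Sf y = 0 := pressureSource_uvf_eq_zero hK.isClosed hs₁ hs₂ hsf (hsup y hy)
      have h2 : Sg y = 0 := pressureSource_uvf_eq_zero hK.isClosed hs₁ hs₂ hsg (hsup y hy)
      rw [Pi.sub_apply, h1, h2, sub_self]
  have hpot : ∀ x, ∫ y, (Sf - Sg) y / (4 * π * ‖x - y‖) =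
      pressureFn (uvf v₁ v₂ f) x - pressureFn (uvf v₁ v₂ g) x := fun x => by
    simp only [Pi.sub_apply, sub_div]
    exact integral_sub (integrable_newtonPotential hSf.continuous hcf x)
      (integrable_newtonPotential hSg.continuous hcg x)
  simp only [hpot] at hlip
  have hemb : ContDiff ℝ 1 fun q : Pt => e3 q.1 q.2 0 := by
    refine (EuclideanSpace.equiv (Fin 3) ℝ).symm.contDiff.comp (contDiff_pi.2 fun i => ?_)
    fin_cases i
    · exact contDiff_fst
    · exact contDiff_snd
    · exact contDiff_const
  have hdf : DifferentiableAt ℝ (pvf v₁ v₂ f) q :=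
    ((contDiff_newtonPotential hSf hcf).comp hemb).differentiable (by simp) q
  have hdg : DifferentiableAt ℝ (pvf v₁ v₂ g) q :=
    ((contDiff_newtonPotential hSg hcg).comp hemb).differentiable (by simp) q
  have hnorm : ‖fderiv ℝ (pvf v₁ v₂ f - pvf v₁ v₂ g) q‖ ≤ 2 * C * (2 / r) * ε := by
    refine norm_fderiv_le_of_lip' ℝ (by positivity) (Eventually.of_forall fun q' => ?_)
    refine (hlip (e3 q'.1 q'.2 0) (e3 q.1 q.2 0)).trans ?_
    calc _ ≤ C * (2 / r * ε) * (2 * ‖q' - q‖) := by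
          gcongr
          exact norm_e3_sub_e3_le q' q
      _ = _ := by ring
  have happly : ∀ e : Pt, ‖e‖ ≤ 1 →
      |fderiv ℝ (pvf v₁ v₂ f) q e - fderiv ℝ (pvf v₁ v₂ g) q e| ≤ 2 * C * (2 / r) * ε := by
    intro e he
    rw [← sub_apply, ← fderiv_sub hdf hdg]
    exact (ContinuousLinearMap.le_opNorm _ _).trans
      ((mul_le_of_le_one_right (norm_nonneg _) he).trans hnorm)
  exact ⟨happly (1, 0) (by simp), happly (0, 1) (by simp)⟩

/-- Lemma A.5: continuity of `∇p[v,f]` with respect to `f`. -/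
theorem statement_19 (K : Set Pt) (hK : IsCompact K) (hKP : K ⊆ Pset)
    (v₁ v₂ : ℕ → Pt → ℝ) (fk : ℕ → Pt → ℝ) (f : Pt → ℝ)
    (hsm : ∀ k : ℕ, ContDiff ℝ (⊤ : ℕ∞) (v₁ k) ∧ ContDiff ℝ (⊤ : ℕ∞) (v₂ k) ∧ ContDiff ℝ (⊤ : ℕ∞) (fk k))
    (hsf : ContDiff ℝ (⊤ : ℕ∞) f)
    (hnn : ∀ (k : ℕ) (p : Pt), 0 ≤ fk k p) (hfnn : ∀ p : Pt, 0 ≤ f p)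
    (hsupp : ∀ k : ℕ, tsupport (v₁ k) ⊆ K ∧ tsupport (v₂ k) ⊆ K ∧ tsupport (fk k) ⊆ K)
    (hsuppf : tsupport f ⊆ K)
    (hlt : ∀ k : ℕ, ∀ p ∈ tsupport (v₁ k) ∪ tsupport (v₂ k),
      Real.sqrt ((v₁ k p) ^ 2 + (v₂ k p) ^ 2) < min (fk k p) (f p))
    (hconv : TendstoUniformlyOn fk f atTop Pset)
    (hconv' : TendstoUniformlyOn (fun k p => fderiv ℝ (fk k) p) (fun p => fderiv ℝ f p)
      atTop Pset) :
    TendstoUniformly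
      (fun (k : ℕ) (q : Pt) =>
        (pdx (pvf (v₁ k) (v₂ k) (fk k)) q - pdx (pvf (v₁ k) (v₂ k) f) q,
         pdy (pvf (v₁ k) (v₂ k) (fk k)) q - pdy (pvf (v₁ k) (v₂ k) f) q))
      (fun _ : Pt => ((0:ℝ), (0:ℝ))) atTop := by
  obtain ⟨C, hC0, hC⟩ := exists_pdx_pdy_pvf_sub_le hK hKP
  obtain ⟨M₁, hM₁⟩ := hK.exists_bound_of_continuousOn hsf.continuous.continuousOn
  obtain ⟨M₂, hM₂⟩ := hK.exists_bound_of_continuousOn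
    (hsf.continuous_fderiv (by simp)).continuousOn
  set M : ℝ := max 0 (max M₁ M₂)
  have hM0 : 0 ≤ M := le_max_left _ _
  have hMf : ∀ p ∈ K, |f p| ≤ M := fun p hp =>
    (hM₁ p hp).trans ((le_max_left _ _).trans (le_max_right _ _))
  have hMd : ∀ p ∈ K, ‖fderiv ℝ f p‖ ≤ M := fun p hp =>
    (hM₂ p hp).trans ((le_max_right _ _).trans (le_max_right _ _))
  have hpdy : ∀ L : Pt →L[ℝ] ℝ, |L (0, 1)| ≤ ‖L‖ := fun L => by
    simpa using L.le_opNorm (0, 1)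
  rw [Metric.tendstoUniformly_iff]
  intro ε hε
  set A : ℝ := C * (2 * M + 1)
  have hA0 : 0 ≤ A := by positivity
  set δ : ℝ := min 1 (ε / (A + 1))
  have hδ0 : 0 < δ := lt_min one_pos (by positivity)
  have hδ1 : δ ≤ 1 := min_le_left _ _
  have hδε : C * (δ * (2 * M + 1)) < ε := by
    have h1 : δ * (A + 1) ≤ ε := (le_div_iff₀ (by positivity)).1 (min_le_right _ _)
    calc C * (δ * (2 * M + 1)) = δ * A := by ring
      _ < ε := by linarith
  filter_upwards [Metric.tendstoUniformlyOn_iff.1 hconv δ hδ0,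
    Metric.tendstoUniformlyOn_iff.1 hconv' δ hδ0] with k hk hk' q
  have hle : (2 : WithTop ℕ∞) ≤ (⊤ : ℕ∞) :=
    WithTop.coe_le_coe.2 (le_top : (2 : ℕ∞) ≤ ⊤)
  obtain ⟨hx, hy⟩ := hC (v₁ k) (v₂ k) (fk k) f (δ * (2 * M + 1)) ((hsm k).1.of_le hle)
    ((hsm k).2.1.of_le hle) ((hsm k).2.2.of_le hle) (hsf.of_le hle) (hnn k) hfnn (hsupp k).1
    (hsupp k).2.1 (hsupp k).2.2 hsuppf (fun p hp => (lt_min_iff.1 (hlt k p hp)).1)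
    (fun p hp => (lt_min_iff.1 (hlt k p hp)).2) (by positivity) (fun p hp => by
      have h1 : |fk k p - f p| ≤ δ := by
        rw [abs_sub_comm]; exact (hk p (hKP hp)).le
      have h2 : |pdy (fk k) p - pdy f p| ≤ δ := by
        refine (hpdy (fderiv ℝ (fk k) p - fderiv ℝ f p)).trans ?_
        rw [← dist_eq_norm, dist_comm]
        exact (hk' p (hKP hp)).le
      have h3 : |pdy f p| ≤ M := (hpdy _).trans (hMd p hp)
      have h4 : |pdy (fk k) p| ≤ M + 1 := by
        have := abs_sub_abs_le_abs_sub (pdy (fk k) p) (pdy f p)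
        linarith
      have h5 : fk k p * pdy (fk k) p - f p * pdy f p =
          (fk k p - f p) * pdy (fk k) p + f p * (pdy (fk k) p - pdy f p) := by ring
      rw [h5]
      calc _ ≤ |fk k p - f p| * |pdy (fk k) p| + |f p| * |pdy (fk k) p - pdy f p| := by
            rw [← abs_mul, ← abs_mul]; exact abs_add_le _ _
        _ ≤ δ * (M + 1) + M * δ := by
            have := hMf p hp
            gcongr
        _ = _ := by ring) q
  rw [dist_comm, Prod.dist_eq, max_lt_iff, Real.dist_0_eq_abs, Real.dist_0_eq_abs]
  exact ⟨hx.trans_lt hδε, hy.trans_lt hδε⟩
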